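/- In the setting of the generalized renormalization-group construction (finite nonempty types 𝒳₁,…,𝒳_d, surjective maps T_i : 𝒳_i → 𝒳_{i+1}, positive weights σ₁,…,σ_d with σ̄_i := σ₁+⋯+σ_i, loss L : 𝒳₁ → ℝ, λ ∈ ℝ, strictly positive reference pmf Q on 𝒳₁ with pushforwards Q^{(i)}, iterates Z₁ := ∑_x exp(−(λ/σ₁)L(x))Q(x), P¹(x) := exp(−(λ/σ₁)L(x))Q(x)/Z₁, and for 1 ≤ i ≤ d−1 with θ_i := σ̄_i/σ̄_{i+1}: Uⁱ := pushforward of Pⁱ under T_i, Z_{i+1} := ∑_y Uⁱ(y)^{θ_i}Q^{(i+1)}(y)^{1−θ_i}, P^{i+1}(y) := Uⁱ(y)^{θ_i}Q^{(i+1)}(y)^{1−θ_i}/Z_{i+1}, and P̃^{[λ]}(x) := P^d(x^{(d)})∏_{i=1}^{d−1}Pⁱ(x^{(i)})/Uⁱ(x^{(i+1)}) with x^{(1)}:=x, x^{(i+1)}:=T_i(x^{(i)})), the pmf P̃^{[λ]} is the unique minimizer over all pmfs P on 𝒳₁ of the hierarchical relative entropy regularization objective ∑_{i=1}^d σ_i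 D(P^{(i)} ‖ Q^{(i)}) + λ ∑_x P(x)L(x), and the minimum value equals −∑_{i=1}^d σ̄_i log Z_i. -/

import Mathlib

open Finset

/-- Relative entropy of finite pmfs: `D(R‖S) = ∑_{x : R x > 0} R x log (R x / S x)`. -/
noncomputable def relEnt {α : Type*} [Fintype α] (R S : α → ℝ) : ℝ :=
  ∑ x ∈ Finset.univ.filter (fun x => 0 < R x), R x * Real.log (R x / S x)

/-- Hierarchical pushforwards: `hpush T P 0 = P` and
`hpush T P (i+1) y = ∑_{x : T i x = y} hpush T P i x`. -/
noncomputable def hpush {X : ℕ → Type*} [∀ i, Fintype (X i)] [∀ i, DecidableEq (X i)]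
    (T : ∀ i, X i → X (i + 1)) (P : X 0 → ℝ) : ∀ i, X i → ℝ
  | 0 => P
  | i + 1 => fun y => ∑ x ∈ Finset.univ.filter (fun x => T i x = y), hpush T P i x

/-- Accumulated hierarchical coefficients `σ̄_i = σ_0 + ⋯ + σ_i` (0-based). -/
noncomputable def sbar (σ : ℕ → ℝ) (i : ℕ) : ℝ := ∑ k ∈ Finset.range (i + 1), σ k

/-- Generalized renormalization-group iterates `Pⁱ` (with reference pmf `Q`):
`P⁰ x = exp(-(λ/σ₀) L x) Q x / Z₀` and, with `θ_i = σ̄_i/σ̄_{i+1}`,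
`P^{i+1} y = (Uⁱ y)^{θ_i} (Q^{(i+1)} y)^{1-θ_i} / Z_{i+1}`, where `Uⁱ` is the
pushforward of `Pⁱ` under `T i` and the `Z`'s are the normalizing constants. -/
noncomputable def GRGP {X : ℕ → Type*} [∀ i, Fintype (X i)] [∀ i, DecidableEq (X i)]
    (T : ∀ i, X i → X (i + 1)) (σ : ℕ → ℝ) (L : X 0 → ℝ) (lam : ℝ)
    (Q : X 0 → ℝ) : ∀ i, X i → ℝ
  | 0 => fun x => Real.exp (-(lam / σ 0) * L x) * Q x /
      ∑ x', Real.exp (-(lam / σ 0) * L x') * Q x'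
  | i + 1 => fun y =>
      (∑ x ∈ Finset.univ.filter (fun x => T i x = y), GRGP T σ L lam Q i x) ^
            (sbar σ i / sbar σ (i + 1)) *
          hpush T Q (i + 1) y ^ (1 - sbar σ i / sbar σ (i + 1)) /
        ∑ y', (∑ x ∈ Finset.univ.filter (fun x => T i x = y'), GRGP T σ L lam Q i x) ^
            (sbar σ i / sbar σ (i + 1)) *
          hpush T Q (i + 1) y' ^ (1 - sbar σ i / sbar σ (i + 1))

/-- The coarse-grained distribution `Uⁱ`, the pushforward of `Pⁱ` under `T i`. -/
noncomputable def GRGU {X : ℕ → Type*} [∀ i, Fintype (X i)] [∀ i, DecidableEq (X i)]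
    (T : ∀ i, X i → X (i + 1)) (σ : ℕ → ℝ) (L : X 0 → ℝ) (lam : ℝ)
    (Q : X 0 → ℝ) (i : ℕ) (y : X (i + 1)) : ℝ :=
  ∑ x ∈ Finset.univ.filter (fun x => T i x = y), GRGP T σ L lam Q i x

/-- The generalized renormalization-group normalizing constants `Z_i`. -/
noncomputable def GRGZ {X : ℕ → Type*} [∀ i, Fintype (X i)] [∀ i, DecidableEq (X i)]
    (T : ∀ i, X i → X (i + 1)) (σ : ℕ → ℝ) (L : X 0 → ℝ) (lam : ℝ)
    (Q : X 0 → ℝ) : ℕ → ℝ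
  | 0 => ∑ x, Real.exp (-(lam / σ 0) * L x) * Q x
  | i + 1 => ∑ y, GRGU T σ L lam Q i y ^ (sbar σ i / sbar σ (i + 1)) *
      hpush T Q (i + 1) y ^ (1 - sbar σ i / sbar σ (i + 1))

/-- The hierarchical trajectory `x^{(i)}` of a point `x`. -/
def liftT {X : ℕ → Type*} (T : ∀ i, X i → X (i + 1)) : ∀ i, X 0 → X i
  | 0 => id
  | i + 1 => fun x => T i (liftT T i x)

/-- The distribution `P̃^{[λ]}`, obtained by disintegration:
`P̃^{[λ]}(x) = P^{d-1}(x^{(d-1)}) ∏_{i<d-1} Pⁱ(x^{(i)}) / Uⁱ(x^{(i+1)})`. -/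
noncomputable def GPtilde {X : ℕ → Type*} [∀ i, Fintype (X i)] [∀ i, DecidableEq (X i)]
    (T : ∀ i, X i → X (i + 1)) (σ : ℕ → ℝ) (L : X 0 → ℝ) (lam : ℝ)
    (Q : X 0 → ℝ) (d : ℕ) (x : X 0) : ℝ :=
  GRGP T σ L lam Q (d - 1) (liftT T (d - 1) x) *
    ∏ i ∈ Finset.range (d - 1),
      (GRGP T σ L lam Q i (liftT T i x) / GRGU T σ L lam Q i (liftT T (i + 1) x))

/-- Pushforward of a weight function on a finite type along a map. -/
noncomputable def push {α β : Type*} [Fintype α] [DecidableEq β] (f : α → β) (R : α → ℝ)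
    (y : β) : ℝ :=
  ∑ x ∈ Finset.univ.filter (fun x => f x = y), R x

section Push

variable {α β : Type*} [Fintype α] [DecidableEq β]

lemma push_nonneg (f : α → β) {R : α → ℝ} (hR : ∀ x, 0 ≤ R x) (y : β) : 0 ≤ push f R y :=
  Finset.sum_nonneg fun x _ => hR x

lemma push_pos {f : α → β} (hf : Function.Surjective f) {R : α → ℝ} (hR : ∀ x, 0 < R x)
    (y : β) : 0 < push f R y := by
  obtain ⟨x, hx⟩ := hf y
  exact Finset.sum_pos (fun x _ => hR x) ⟨x, by simp [hx]⟩

lemma le_push (f : α → β) {R : α → ℝ} (hR : ∀ x, 0 ≤ R x) (x : α) : R x ≤ push f R (f x) :=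
  Finset.single_le_sum (f := R) (fun x _ => hR x) (by simp)

lemma push_apply_pos (f : α → β) {R : α → ℝ} (hR : ∀ x, 0 < R x) (x : α) :
    0 < push f R (f x) :=
  (hR x).trans_le (le_push f (fun x => (hR x).le) x)

lemma push_mul_comp (f : α → β) (R : α → ℝ) (g : β → ℝ) (y : β) :
    push f (fun x => R x * g (f x)) y = push f R y * g y := by
  unfold push
  rw [Finset.sum_mul]
  refine Finset.sum_congr rfl fun x hx => ?_
  simp only [(Finset.mem_filter.mp hx).2]

lemma sum_push [Fintype β] (f : α → β) (R : α → ℝ) : ∑ y, push f R y = ∑ x, R x :=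
  Finset.sum_fiberwise _ _ _

lemma sum_push_mul [Fintype β] (f : α → β) (R : α → ℝ) (g : β → ℝ) :
    ∑ y, push f R y * g y = ∑ x, R x * g (f x) := by
  simp_rw [← push_mul_comp]
  exact sum_push f _

end Push

section RelEnt

variable {α β : Type*} [Fintype α]

lemma relEnt_eq_sum {R S : α → ℝ} (hR : ∀ x, 0 ≤ R x) :
    relEnt R S = ∑ x, R x * Real.log (R x / S x) := by
  refine Finset.sum_subset (Finset.subset_univ _) fun x _ hx => ?_
  have : R x = 0 := le_antisymm (by simpa using hx) (hR x)
  simp [this]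

lemma relEnt_self (R : α → ℝ) : relEnt R R = 0 := by
  refine Finset.sum_eq_zero fun x hx => ?_
  rw [div_self (Finset.mem_filter.mp hx).2.ne']
  simp

lemma sub_lt_mul_log_div {a b : ℝ} (ha : 0 ≤ a) (hb : 0 ≤ b) (hab : b = 0 → a = 0)
    (hne : a ≠ b) : a - b < a * Real.log (a / b) := by
  rcases ha.eq_or_lt with rfl | ha
  · have : 0 < b := hb.lt_of_ne hne
    simpa using this
  have hb' : 0 < b := hb.lt_of_ne fun h => ha.ne' (hab h.symm)
  have h := Real.log_lt_sub_one_of_pos (div_pos hb' ha)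
    fun h => hne ((div_eq_one_iff_eq ha.ne').mp h).symm
  rw [← inv_div a b, Real.log_inv, inv_div] at h
  have h2 := mul_lt_mul_of_pos_left h ha
  have h3 : a * (b / a - 1) = b - a := by field_simp
  linarith

/-- Strict Gibbs inequality. -/
lemma relEnt_pos {R S : α → ℝ} (hR : ∀ x, 0 ≤ R x) (hS : ∀ x, 0 ≤ S x)
    (hac : ∀ x, S x = 0 → R x = 0) (hsum : ∑ x, R x = ∑ x, S x) (hne : R ≠ S) :
    0 < relEnt R S := by
  rw [relEnt_eq_sum hR]
  obtain ⟨x₀, hx₀⟩ := Function.ne_iff.mp hne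
  have h : ∑ x, (R x - S x) < ∑ x, R x * Real.log (R x / S x) := by
    refine Finset.sum_lt_sum (fun x _ => ?_)
      ⟨x₀, Finset.mem_univ _, sub_lt_mul_log_div (hR _) (hS _) (hac _) hx₀⟩
    by_cases hx : R x = S x
    · rw [hx, sub_self]
      by_cases h0 : S x = 0 <;> simp [h0]
    · exact (sub_lt_mul_log_div (hR _) (hS _) (hac _) hx).le
  rwa [Finset.sum_sub_distrib, hsum, sub_self] at h

lemma relEnt_nonneg {R S : α → ℝ} (hR : ∀ x, 0 ≤ R x) (hS : ∀ x, 0 ≤ S x)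
    (hac : ∀ x, S x = 0 → R x = 0) (hsum : ∑ x, R x = ∑ x, S x) :
    0 ≤ relEnt R S := by
  by_cases h : R = S
  · rw [h, relEnt_self]
  · exact (relEnt_pos hR hS hac hsum h).le

variable [DecidableEq β]

/-- The weight with the fibrewise conditional law of `S` and the marginal of `R`. -/
noncomputable def glue (f : α → β) (R S : α → ℝ) (x : α) : ℝ :=
  S x / push f S (f x) * push f R (f x)

lemma glue_nonneg (f : α → β) {R S : α → ℝ} (hR : ∀ x, 0 ≤ R x) (hS : ∀ x, 0 < S x)
    (x : α) : 0 ≤ glue f R S x :=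
  mul_nonneg (div_nonneg (hS x).le (push_apply_pos f hS x).le) (push_nonneg f hR _)

lemma eq_zero_of_glue_eq_zero (f : α → β) {R S : α → ℝ} (hR : ∀ x, 0 ≤ R x)
    (hS : ∀ x, 0 < S x) (x : α) (h : glue f R S x = 0) : R x = 0 := by
  have h1 := div_pos (hS x) (push_apply_pos f hS x)
  have h2 : push f R (f x) = 0 := (mul_eq_zero.mp h).resolve_left h1.ne'
  exact le_antisymm (h2 ▸ le_push f hR x) (hR x)

variable [Fintype β]

/-- Chain rule for the relative entropy. -/
lemma relEnt_sub_relEnt_push (f : α → β) {R S : α → ℝ} (hR : ∀ x, 0 ≤ R x)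
    (hS : ∀ x, 0 < S x) :
    relEnt R S - relEnt (push f R) (push f S) = relEnt R (glue f R S) := by
  rw [relEnt_eq_sum hR, relEnt_eq_sum hR, relEnt_eq_sum (push_nonneg f hR),
    sum_push_mul f R fun y => Real.log (push f R y / push f S y), ← Finset.sum_sub_distrib]
  refine Finset.sum_congr rfl fun x _ => ?_
  rcases (hR x).eq_or_lt with h | h
  · simp [← h]
  have h1 := hS x
  have h2 := push_apply_pos f hS x
  have h3 := h.trans_le (le_push f hR x)
  unfold glue
  rw [Real.log_div h.ne' h1.ne', Real.log_div h3.ne' h2.ne',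
    Real.log_div h.ne' (by positivity), Real.log_mul (by positivity) h3.ne',
    Real.log_div h1.ne' h2.ne']
  ring

lemma sum_glue (f : α → β) {R S : α → ℝ} (hS : ∀ x, 0 < S x) :
    ∑ x, R x = ∑ x, glue f R S x := by
  have h : ∑ x, glue f R S x = ∑ x, S x * (fun y => push f R y / push f S y) (f x) :=
    Finset.sum_congr rfl fun x _ => by unfold glue; ring
  rw [h, ← sum_push_mul f S fun y => push f R y / push f S y, ← sum_push f R]
  refine Finset.sum_congr rfl fun y _ => ?_
  by_cases hy : ∃ x, f x = y
  · obtain ⟨x, rfl⟩ := hy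
    exact (mul_div_cancel₀ _ (push_apply_pos f hS x).ne').symm
  · have : push f R y = 0 := Finset.sum_eq_zero fun x hx =>
      (hy ⟨x, (Finset.mem_filter.mp hx).2⟩).elim
    simp [this]

lemma relEnt_push_le (f : α → β) {R S : α → ℝ} (hR : ∀ x, 0 ≤ R x) (hS : ∀ x, 0 < S x) :
    relEnt (push f R) (push f S) ≤ relEnt R S := by
  have := relEnt_nonneg hR (glue_nonneg f hR hS) (eq_zero_of_glue_eq_zero f hR hS)
    (sum_glue f hS)
  rw [← relEnt_sub_relEnt_push f hR hS] at this
  linarith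

lemma relEnt_push_lt (f : α → β) {R S : α → ℝ} (hR : ∀ x, 0 ≤ R x) (hS : ∀ x, 0 < S x)
    (hne : R ≠ glue f R S) : relEnt (push f R) (push f S) < relEnt R S := by
  have := relEnt_pos hR (glue_nonneg f hR hS) (eq_zero_of_glue_eq_zero f hR hS)
    (sum_glue f hS) hne
  rw [← relEnt_sub_relEnt_push f hR hS] at this
  linarith

lemma relEnt_push_eq (f : α → β) {R S : α → ℝ} (hR : ∀ x, 0 ≤ R x) (hS : ∀ x, 0 < S x)
    (h : R = glue f R S) : relEnt (push f R) (push f S) = relEnt R S := by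
  have := relEnt_sub_relEnt_push f hR hS
  rw [← h, relEnt_self] at this
  linarith

end RelEnt

section Hierarchy

variable {X : ℕ → Type*} [∀ i, Fintype (X i)] [∀ i, DecidableEq (X i)]
  {T : ∀ i, X i → X (i + 1)}

lemma hpush_succ (P : X 0 → ℝ) (i : ℕ) : hpush T P (i + 1) = push (T i) (hpush T P i) := rfl

lemma hpush_nonneg {P : X 0 → ℝ} (hP : ∀ x, 0 ≤ P x) : ∀ i x, 0 ≤ hpush T P i x
  | 0, x => hP x
  | i + 1, x => push_nonneg (T i) (hpush_nonneg hP i) x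

lemma sum_hpush (P : X 0 → ℝ) : ∀ i, ∑ x, hpush T P i x = ∑ x, P x
  | 0 => rfl
  | i + 1 => (sum_push (T i) _).trans (sum_hpush P i)

lemma hpush_pos {n : ℕ} (hT : ∀ i, i < n → Function.Surjective (T i)) {Q : X 0 → ℝ}
    (hQ : ∀ x, 0 < Q x) : ∀ i, i ≤ n → ∀ x, 0 < hpush T Q i x
  | 0, _, x => hQ x
  | i + 1, hi, x => push_pos (hT i hi) (hpush_pos hT hQ i (by omega)) x

lemma sbar_succ (σ : ℕ → ℝ) (i : ℕ) : sbar σ (i + 1) = sbar σ i + σ (i + 1) :=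
  Finset.sum_range_succ _ _

lemma sbar_pos {σ : ℕ → ℝ} {n : ℕ} (hσ : ∀ i, i ≤ n → 0 < σ i) {i : ℕ} (hi : i ≤ n) :
    0 < sbar σ i :=
  Finset.sum_pos (fun k hk => hσ k (by have := Finset.mem_range.mp hk; omega)) ⟨0, by simp⟩

variable {σ : ℕ → ℝ} {L : X 0 → ℝ} {lam : ℝ} {Q : X 0 → ℝ}

lemma GRGU_eq (i : ℕ) : GRGU T σ L lam Q i = push (T i) (GRGP T σ L lam Q i) := rfl

lemma GRGP_zero_apply (x : X 0) :
    GRGP T σ L lam Q 0 x = Real.exp (-(lam / σ 0) * L x) * Q x / GRGZ T σ L lam Q 0 := rfl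

lemma GRGP_succ_apply (i : ℕ) (y : X (i + 1)) :
    GRGP T σ L lam Q (i + 1) y =
      GRGU T σ L lam Q i y ^ (sbar σ i / sbar σ (i + 1)) *
        hpush T Q (i + 1) y ^ (1 - sbar σ i / sbar σ (i + 1)) / GRGZ T σ L lam Q (i + 1) := rfl

variable {n : ℕ}

/-- The law on `X i` whose marginal `j` levels above is `GRGP` and whose successive conditional
laws are those of the iterates `GRGP`. -/
noncomputable def gluedLaw (T : ∀ i, X i → X (i + 1)) (σ : ℕ → ℝ) (L : X 0 → ℝ) (lam : ℝ)
    (Q : X 0 → ℝ) : ℕ → ∀ i, X i → ℝ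
  | 0 => GRGP T σ L lam Q
  | j + 1 => fun i x =>
      GRGP T σ L lam Q i x / GRGU T σ L lam Q i (T i x) * gluedLaw T σ L lam Q j (i + 1) (T i x)

lemma gluedLaw_liftT (x : X 0) (j i m : ℕ) (h : i + j = m) :
    gluedLaw T σ L lam Q j i (liftT T i x) =
      GRGP T σ L lam Q m (liftT T m x) * ∏ k ∈ Finset.Ico i m,
        (GRGP T σ L lam Q k (liftT T k x) / GRGU T σ L lam Q k (liftT T (k + 1) x)) := by
  induction j generalizing i with
  | zero =>
    obtain rfl : i = m := h
    simp [gluedLaw]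
  | succ j ih =>
    rw [Finset.prod_eq_prod_Ico_succ_bot (by omega), mul_left_comm, ← ih (i + 1) (by omega)]
    rfl

lemma GPtilde_eq_gluedLaw : GPtilde T σ L lam Q (n + 1) = gluedLaw T σ L lam Q n 0 := by
  funext x
  have := gluedLaw_liftT (T := T) (σ := σ) (L := L) (lam := lam) (Q := Q) x n 0 n (zero_add n)
  rw [← Finset.range_eq_Ico] at this
  exact this.symm

lemma eq_gluedLaw {P : X 0 → ℝ} (htop : hpush T P n = GRGP T σ L lam Q n)
    (hglue : ∀ i, i < n →
      hpush T P i = glue (T i) (hpush T P i) (GRGP T σ L lam Q i)) :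
    P = gluedLaw T σ L lam Q n 0 := by
  suffices ∀ j i, i + j = n → hpush T P i = gluedLaw T σ L lam Q j i from
    this n 0 (zero_add n)
  intro j
  induction j with
  | zero =>
    rintro i rfl
    exact htop
  | succ j ih =>
    intro i hi
    rw [hglue i (by omega)]
    funext x
    rw [glue, ← hpush_succ, ih (i + 1) (by omega)]
    rfl

variable [∀ i, Nonempty (X i)]

lemma GRGZ_pos_and_GRGP_pos (hT : ∀ i, i < n → Function.Surjective (T i))
    (hQ : ∀ x, 0 < Q x) (i : ℕ) (hi : i ≤ n) :
    0 < GRGZ T σ L lam Q i ∧ ∀ x, 0 < GRGP T σ L lam Q i x := by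
  induction i with
  | zero =>
    have h (x) : 0 < Real.exp (-(lam / σ 0) * L x) * Q x := mul_pos (Real.exp_pos _) (hQ x)
    have hZ : 0 < GRGZ T σ L lam Q 0 :=
      Finset.sum_pos (fun x _ => h x) Finset.univ_nonempty
    exact ⟨hZ, fun x => div_pos (h x) hZ⟩
  | succ i ih =>
    have h (y) : 0 < GRGU T σ L lam Q i y ^ (sbar σ i / sbar σ (i + 1)) *
        hpush T Q (i + 1) y ^ (1 - sbar σ i / sbar σ (i + 1)) :=
      mul_pos (Real.rpow_pos_of_pos (push_pos (hT i hi) (ih (by omega)).2 y) _)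
        (Real.rpow_pos_of_pos (hpush_pos hT hQ _ hi y) _)
    have hZ : 0 < GRGZ T σ L lam Q (i + 1) :=
      Finset.sum_pos (fun x _ => h x) Finset.univ_nonempty
    exact ⟨hZ, fun x => div_pos (h x) hZ⟩

lemma sum_GRGP (hT : ∀ i, i < n → Function.Surjective (T i))
    (hQ : ∀ x, 0 < Q x) (i : ℕ) (hi : i ≤ n) : ∑ x, GRGP T σ L lam Q i x = 1 := by
  have hZ := (GRGZ_pos_and_GRGP_pos (σ := σ) (L := L) (lam := lam) hT hQ i hi).1.ne'
  cases i with
  | zero =>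
    simp_rw [GRGP_zero_apply]
    rw [← Finset.sum_div]
    exact div_self hZ
  | succ i =>
    simp_rw [GRGP_succ_apply]
    rw [← Finset.sum_div]
    exact div_self hZ

/-- Decomposition of the regularized objective into conditional relative entropies. -/
lemma objective_eq (hT : ∀ i, i < n → Function.Surjective (T i))
    (hσ : ∀ i, i ≤ n → 0 < σ i) (hQ : ∀ x, 0 < Q x) {P : X 0 → ℝ} (hP : ∀ x, 0 ≤ P x)
    (hP1 : ∑ x, P x = 1) (m : ℕ) (hm : m ≤ n) :
    ∑ i ∈ Finset.range (m + 1), σ i * relEnt (hpush T P i) (hpush T Q i) +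
        lam * ∑ x, P x * L x =
      sbar σ m * relEnt (hpush T P m) (GRGP T σ L lam Q m) +
        ∑ i ∈ Finset.range m, sbar σ i *
          (relEnt (hpush T P i) (GRGP T σ L lam Q i) -
            relEnt (hpush T P (i + 1)) (GRGU T σ L lam Q i)) -
        ∑ i ∈ Finset.range (m + 1), sbar σ i * Real.log (GRGZ T σ L lam Q i) := by
  induction m with
  | zero =>
    have hs := hσ 0 hm
    have hZ := (GRGZ_pos_and_GRGP_pos (σ := σ) (L := L) (lam := lam) hT hQ 0 hm).1
    have hZ1 : σ 0 * Real.log (GRGZ T σ L lam Q 0) =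
        ∑ x, P x * (σ 0 * Real.log (GRGZ T σ L lam Q 0)) := by
      rw [← Finset.sum_mul, hP1, one_mul]
    simp only [zero_add, Finset.range_one, Finset.sum_singleton, Finset.range_zero,
      Finset.sum_empty, add_zero, sbar]
    rw [hZ1, relEnt_eq_sum (hpush_nonneg hP 0), relEnt_eq_sum (hpush_nonneg hP 0),
      Finset.mul_sum, Finset.mul_sum, Finset.mul_sum, ← Finset.sum_add_distrib,
      ← Finset.sum_sub_distrib]
    refine Finset.sum_congr rfl fun x _ => ?_
    rw [GRGP_zero_apply]
    change σ 0 * (P x * Real.log (P x / Q x)) + _ = σ 0 * (P x * Real.log (P x / _)) - _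
    rcases (hP x).eq_or_lt with h | h
    · simp [← h]
    have hq := hQ x
    rw [Real.log_div h.ne' hq.ne', Real.log_div h.ne' (by positivity),
      Real.log_div (by positivity) hZ.ne', Real.log_mul (by positivity) hq.ne', Real.log_exp]
    field_simp
    ring
  | succ m ih =>
    have hs := sbar_pos hσ hm
    have hZ := (GRGZ_pos_and_GRGP_pos (σ := σ) (L := L) (lam := lam) hT hQ _ hm).1
    have key : sbar σ m * relEnt (hpush T P (m + 1)) (GRGU T σ L lam Q m) +
        σ (m + 1) * relEnt (hpush T P (m + 1)) (hpush T Q (m + 1)) =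
        sbar σ (m + 1) * relEnt (hpush T P (m + 1)) (GRGP T σ L lam Q (m + 1)) -
        sbar σ (m + 1) * Real.log (GRGZ T σ L lam Q (m + 1)) := by
      have hZ1 : sbar σ (m + 1) * Real.log (GRGZ T σ L lam Q (m + 1)) =
          ∑ x, hpush T P (m + 1) x * (sbar σ (m + 1) * Real.log (GRGZ T σ L lam Q (m + 1))) := by
        rw [← Finset.sum_mul, sum_hpush, hP1, one_mul]
      have hPm := hpush_nonneg (T := T) hP (m + 1)
      rw [hZ1, relEnt_eq_sum hPm, relEnt_eq_sum hPm, relEnt_eq_sum hPm,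
        Finset.mul_sum, Finset.mul_sum, Finset.mul_sum, ← Finset.sum_add_distrib,
        ← Finset.sum_sub_distrib]
      refine Finset.sum_congr rfl fun x _ => ?_
      rw [GRGP_succ_apply]
      rcases (hPm x).eq_or_lt with h | h
      · simp [← h]
      have hq := hpush_pos hT hQ _ hm x
      have hu : 0 < GRGU T σ L lam Q m x :=
        push_pos (hT m hm) (GRGZ_pos_and_GRGP_pos hT hQ m (by omega)).2 x
      rw [Real.log_div h.ne' hu.ne', Real.log_div h.ne' hq.ne',
        Real.log_div h.ne' (by positivity), Real.log_div (by positivity) hZ.ne',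
        Real.log_mul (by positivity) (by positivity), Real.log_rpow hu, Real.log_rpow hq]
      have hs' := sbar_succ σ m
      have hσ' : σ (m + 1) = sbar σ (m + 1) - sbar σ m := by linarith
      rw [hσ']
      field_simp
      ring
    rw [Finset.sum_range_succ, Finset.sum_range_succ _ (m + 1),
      Finset.sum_range_succ (fun i => sbar σ i *
        (relEnt (hpush T P i) (GRGP T σ L lam Q i) -
          relEnt (hpush T P (i + 1)) (GRGU T σ L lam Q i))) m]
    have := ih (by omega)
    linarith

lemma push_gluedLaw_succ (hT : ∀ i, i < n → Function.Surjective (T i))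
    (hQ : ∀ x, 0 < Q x) (j i : ℕ) (hi : i < n) :
    push (T i) (gluedLaw T σ L lam Q (j + 1) i) = gluedLaw T σ L lam Q j (i + 1) := by
  funext y
  have hu : 0 < GRGU T σ L lam Q i y :=
    push_pos (hT i hi) (GRGZ_pos_and_GRGP_pos hT hQ i hi.le).2 y
  have h : gluedLaw T σ L lam Q (j + 1) i = fun x => GRGP T σ L lam Q i x *
      (fun y => gluedLaw T σ L lam Q j (i + 1) y / GRGU T σ L lam Q i y) (T i x) := by
    funext x
    simp only [gluedLaw]
    ring
  rw [h, push_mul_comp (T i) (GRGP T σ L lam Q i)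
    fun y => gluedLaw T σ L lam Q j (i + 1) y / GRGU T σ L lam Q i y, ← GRGU_eq]
  exact mul_div_cancel₀ _ hu.ne'

lemma hpush_gluedLaw (hT : ∀ i, i < n → Function.Surjective (T i))
    (hQ : ∀ x, 0 < Q x) (i j : ℕ) (h : i + j = n) :
    hpush T (gluedLaw T σ L lam Q n 0) i = gluedLaw T σ L lam Q j i := by
  induction i generalizing j with
  | zero =>
    obtain rfl : j = n := by omega
    rfl
  | succ i ih =>
    rw [hpush_succ, ih (j + 1) (by omega), push_gluedLaw_succ hT hQ j i (by omega)]

lemma gluedLaw_pos (hT : ∀ i, i < n → Function.Surjective (T i))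
    (hQ : ∀ x, 0 < Q x) (j i : ℕ) (h : i + j = n) (x : X i) :
    0 < gluedLaw T σ L lam Q j i x := by
  induction j generalizing i with
  | zero => exact (GRGZ_pos_and_GRGP_pos hT hQ i (by omega)).2 x
  | succ j ih =>
    have hG := (GRGZ_pos_and_GRGP_pos (σ := σ) (L := L) (lam := lam) hT hQ i (by omega)).2
    exact mul_pos (div_pos (hG x) (push_apply_pos (T i) hG x)) (ih (i + 1) (by omega) _)

lemma sum_gluedLaw (hT : ∀ i, i < n → Function.Surjective (T i))
    (hQ : ∀ x, 0 < Q x) : ∑ x, gluedLaw T σ L lam Q n 0 x = 1 := by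
  rw [← sum_hpush (T := T) _ n, hpush_gluedLaw hT hQ n 0 (by omega)]
  exact sum_GRGP hT hQ n le_rfl

lemma objective_gluedLaw (hT : ∀ i, i < n → Function.Surjective (T i))
    (hσ : ∀ i, i ≤ n → 0 < σ i) (hQ : ∀ x, 0 < Q x) :
    ∑ i ∈ Finset.range (n + 1),
        σ i * relEnt (hpush T (gluedLaw T σ L lam Q n 0) i) (hpush T Q i) +
        lam * ∑ x, gluedLaw T σ L lam Q n 0 x * L x =
      -∑ i ∈ Finset.range (n + 1), sbar σ i * Real.log (GRGZ T σ L lam Q i) := by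
  have hP (x) : 0 ≤ gluedLaw T σ L lam Q n 0 x := (gluedLaw_pos hT hQ n 0 (by omega) x).le
  rw [objective_eq hT hσ hQ hP (sum_gluedLaw hT hQ) n le_rfl,
    hpush_gluedLaw hT hQ n 0 (by omega)]
  have h0 : relEnt (gluedLaw T σ L lam Q 0 n) (GRGP T σ L lam Q n) = 0 := relEnt_self _
  rw [h0, Finset.sum_eq_zero fun i hi => ?_]
  · ring
  have hi : i < n := Finset.mem_range.mp hi
  rw [hpush_succ, GRGU_eq, relEnt_push_eq (T i) (hpush_nonneg hP i)
    (GRGZ_pos_and_GRGP_pos hT hQ i hi.le).2]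
  · ring
  funext x
  rw [glue, ← hpush_succ, hpush_gluedLaw hT hQ (i + 1) (n - i - 1) (by omega),
    hpush_gluedLaw hT hQ i (n - i - 1 + 1) (by omega)]
  rfl

lemma lt_objective (hT : ∀ i, i < n → Function.Surjective (T i))
    (hσ : ∀ i, i ≤ n → 0 < σ i) (hQ : ∀ x, 0 < Q x) {P : X 0 → ℝ} (hP : ∀ x, 0 ≤ P x)
    (hP1 : ∑ x, P x = 1) (hne : P ≠ gluedLaw T σ L lam Q n 0) :
    -∑ i ∈ Finset.range (n + 1), sbar σ i * Real.log (GRGZ T σ L lam Q i) <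
      ∑ i ∈ Finset.range (n + 1), σ i * relEnt (hpush T P i) (hpush T Q i) +
        lam * ∑ x, P x * L x := by
  rw [objective_eq hT hσ hQ hP hP1 n le_rfl]
  have hG (i) (hi : i ≤ n) := (GRGZ_pos_and_GRGP_pos (σ := σ) (L := L) (lam := lam) hT hQ i hi).2
  have hPn := hpush_nonneg (T := T) hP
  have hac (x) (h : GRGP T σ L lam Q n x = 0) : hpush T P n x = 0 :=
    absurd h (hG n le_rfl x).ne'
  have hsum : ∑ x, hpush T P n x = ∑ x, GRGP T σ L lam Q n x := by
    rw [sum_hpush, hP1, sum_GRGP hT hQ n le_rfl]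
  have hs := sbar_pos hσ (le_refl n)
  have hterm (i) (hi : i ∈ Finset.range n) : 0 ≤ sbar σ i *
      (relEnt (hpush T P i) (GRGP T σ L lam Q i) -
        relEnt (hpush T P (i + 1)) (GRGU T σ L lam Q i)) := by
    have hi := (Finset.mem_range.mp hi).le
    exact mul_nonneg (sbar_pos hσ hi).le
      (sub_nonneg.mpr (relEnt_push_le (T i) (hPn i) (hG i hi)))
  by_cases htop : hpush T P n = GRGP T σ L lam Q n
  · have hex : ∃ i < n, hpush T P i ≠ glue (T i) (hpush T P i) (GRGP T σ L lam Q i) := by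
      by_contra! h
      exact hne (eq_gluedLaw htop h)
    obtain ⟨i, hi, hine⟩ := hex
    have h1 := Finset.sum_pos' hterm ⟨i, Finset.mem_range.mpr hi,
      mul_pos (sbar_pos hσ hi.le)
        (sub_pos.mpr (relEnt_push_lt (T i) (hPn i) (hG i hi.le) hine))⟩
    have h2 := mul_nonneg hs.le
      (relEnt_nonneg (hPn n) (fun x => (hG n le_rfl x).le) hac hsum)
    linarith
  · have h1 := Finset.sum_nonneg hterm
    have h2 := mul_pos hs
      (relEnt_pos (hPn n) (fun x => (hG n le_rfl x).le) hac hsum htop)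
    linarith

end Hierarchy

/-- The pmf `P̃^{[λ]}` is the unique minimizer of the hierarchical relative
entropy regularization objective `D_{(σ,T)}(P‖Q) + λ E_P[L]` over pmfs on
`X 0`, and the minimum value is `-∑ σ̄_i log Z_i`. -/
theorem stmt_17 (d : ℕ) (hd : 1 ≤ d) (X : ℕ → Type*) [∀ i, Fintype (X i)]
    [∀ i, Nonempty (X i)] [∀ i, DecidableEq (X i)]
    (T : ∀ i, X i → X (i + 1)) (hT : ∀ i, i < d - 1 → Function.Surjective (T i))
    (σ : ℕ → ℝ) (hσ : ∀ i, i < d → 0 < σ i) (L : X 0 → ℝ) (lam : ℝ)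
    (Q : X 0 → ℝ) (hQpos : ∀ x, 0 < Q x) (hQ1 : ∑ x, Q x = 1) :
    (∀ x, 0 ≤ GPtilde T σ L lam Q d x) ∧
    (∑ x, GPtilde T σ L lam Q d x = 1) ∧
    (∑ i ∈ Finset.range d,
          σ i * relEnt (hpush T (GPtilde T σ L lam Q d) i) (hpush T Q i) +
        lam * ∑ x, GPtilde T σ L lam Q d x * L x =
      -∑ i ∈ Finset.range d, sbar σ i * Real.log (GRGZ T σ L lam Q i)) ∧
    ∀ P : X 0 → ℝ, (∀ x, 0 ≤ P x) → (∑ x, P x = 1) → P ≠ GPtilde T σ L lam Q d →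
      -∑ i ∈ Finset.range d, sbar σ i * Real.log (GRGZ T σ L lam Q i) <
        ∑ i ∈ Finset.range d, σ i * relEnt (hpush T P i) (hpush T Q i) +
          lam * ∑ x, P x * L x := by
  obtain ⟨n, rfl⟩ : ∃ n, d = n + 1 := ⟨d - 1, by omega⟩
  have hσ' (i) (hi : i ≤ n) : 0 < σ i := hσ i (by omega)
  rw [GPtilde_eq_gluedLaw]
  exact ⟨fun x => (gluedLaw_pos hT hQpos n 0 (by omega) x).le, sum_gluedLaw hT hQpos,
    objective_gluedLaw hT hσ' hQpos, fun P hP hP1 hne => lt_objective hT hσ' hQpos hP hP1 hne⟩
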